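/- There exists an absolute constant c > 0 such that for every squarefree positive integer N, every positive divisor ℓ of N, every g ∈ SL₂(ℝ), every δ ∈ (0,1] and every L > 0: every nonzero trace-zero matrix γ ∈ R(ℓ;g)⁰ with γ ∈ Ψ(δ,L) satisfies L ≥ c·min{ℓ^{−1/2}, ℓ^{−1}·H(g)^{−1}·δ^{−1/2}}; equivalently, the first successive minimum of R(ℓ;g)⁰ with respect to Ψ(δ,1) is ≥ c·min{ℓ^{−1/2}, ℓ^{−1}·H(g)^{−1}·δ^{−1/2}}. -/

import Mathlib

open MeasureTheory Real Matrix Set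

noncomputable section

/-- 2×2 real matrices. -/
abbrev M2 := Matrix (Fin 2) (Fin 2) ℝ

/-- The lattice R(ℓ) = { (a, b; c, d) : a, d ∈ ℤ, b ∈ (1/ℓ)ℤ, c ∈ (N/ℓ)ℤ }. -/
def Rlat (N ℓ : ℕ) : Set M2 :=
  {γ | (∃ n : ℤ, γ 0 0 = (n : ℝ)) ∧ (∃ n : ℤ, γ 0 1 = (n : ℝ) / ℓ) ∧
       (∃ n : ℤ, γ 1 0 = (n : ℝ) * N / ℓ) ∧ (∃ n : ℤ, γ 1 1 = (n : ℝ))}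

/-- The conjugated lattice R(ℓ;g) = g⁻¹ · R(ℓ) · g. -/
def Rconj (N ℓ : ℕ) (g : M2) : Set M2 := {γ | g * γ * g⁻¹ ∈ Rlat N ℓ}

/-- P(γ): half the sum of the squares of the four entries of γ. -/
def Pfun (γ : M2) : ℝ := ((γ 0 0) ^ 2 + (γ 0 1) ^ 2 + (γ 1 0) ^ 2 + (γ 1 1) ^ 2) / 2

/-- Ω(δ,L) = {γ : P(γ) ≤ L² and P(γ) − det γ ≤ 2δL²}. -/
def OmegaSet (δ L : ℝ) : Set M2 := {γ | Pfun γ ≤ L ^ 2 ∧ Pfun γ - γ.det ≤ 2 * δ * L ^ 2}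

/-- Ω⋆(δ,L): nonzero elements of Ω(δ,L). -/
def OmegaStar (δ L : ℝ) : Set M2 := {γ | γ ∈ OmegaSet δ L ∧ γ ≠ 0}

/-- Ψ(δ,L) = {γ : P(γ) ≤ L² and P(γ) + det γ ≤ 2δL²}. -/
def PsiSet (δ L : ℝ) : Set M2 := {γ | Pfun γ ≤ L ^ 2 ∧ Pfun γ + γ.det ≤ 2 * δ * L ^ 2}

/-- Ψ⋆(δ,L): nonzero elements of Ψ(δ,L). -/
def PsiStar (δ L : ℝ) : Set M2 := {γ | γ ∈ PsiSet δ L ∧ γ ≠ 0}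

/-- Möbius action of a 2×2 real matrix on a complex number. -/
def moebius (m : M2) (z : ℂ) : ℂ :=
  ((m 0 0 : ℂ) * z + (m 0 1 : ℂ)) / ((m 1 0 : ℂ) * z + (m 1 1 : ℂ))

/-- A₀(N): determinant-one matrices of the form Q^{−1/2}·(Qa, b; Nc, Qd)
    with Q a positive divisor of N and a,b,c,d ∈ ℤ. -/
def AtkinLehner (N : ℕ) : Set M2 :=
  {σ | σ.det = 1 ∧ ∃ (Q : ℕ) (a b c d : ℤ), 0 < Q ∧ Q ∣ N ∧
     σ = (Real.sqrt Q)⁻¹ • !![(Q : ℝ) * a, (b : ℝ); (N : ℝ) * c, (Q : ℝ) * d]}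

/-- H(g) = sup_{σ ∈ A₀(N)} Im(σ·(g·i)). -/
def Hgt (N : ℕ) (g : M2) : ℝ :=
  sSup ((fun σ => (moebius σ (moebius g Complex.I)).im) '' AtkinLehner N)

set_option maxHeartbeats 2000000

lemma int_param (N l k : ℕ) (hN : Squarefree N) (hNp : 0 < N) (hl : 0 < l) (hNl : N = l * k)
    (a b c : ℤ) (h : a ^ 2 * l + b * c * k = 0) (hne : ¬ (a = 0 ∧ b = 0 ∧ c = 0)) :
    ∃ (Q g0 : ℕ) (c' D m : ℤ), N = g0 * Q ∧ IsCoprime ((Q : ℤ) * D) ((g0 : ℤ) * c') ∧ m ≠ 0 ∧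
      a = m * k * c' * D ∧ b = m * Q * D ^ 2 ∧ c = - (m * g0 * c' ^ 2) := by
  have hl' : (l : ℤ) ≠ 0 := by exact_mod_cast hl.ne'
  by_cases hb : b = 0
  · have ha : a = 0 := by
      subst hb
      have : a ^ 2 * (l : ℤ) = 0 := by linarith
      rcases mul_eq_zero.1 this with h1 | h1
      · exact pow_eq_zero_iff (two_ne_zero) |>.1 h1
      · exact absurd h1 hl'
    refine ⟨N, 1, 1, 0, -c, by simp, by simp [isCoprime_one_right], ?_, by simp [ha], by simp [hb],
      by simp⟩
    intro hc
    exact hne ⟨ha, hb, by simpa using hc⟩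
  · have hd0 : (Int.gcd (a * l) b : ℤ) ≠ 0 := by
      intro h0
      exact hb (Int.gcd_eq_zero_iff.1 (by exact_mod_cast h0)).2
    obtain ⟨C, hC⟩ := Int.gcd_dvd_left (a * l) b
    obtain ⟨D, hD⟩ := Int.gcd_dvd_right (a * l) b
    have hcop : IsCoprime C D := by
      have hbz := Int.gcd_eq_gcd_ab (a * l) b
      refine ⟨Int.gcdA (a * l) b, Int.gcdB (a * l) b, ?_⟩
      apply mul_left_cancel₀ hd0
      generalize Int.gcdA (a * l) b = x at *
      generalize Int.gcdB (a * l) b = y at *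
      linear_combination -hbz - x * hC - y * hD
    generalize (Int.gcd (a * l) b : ℤ) = d at *
    have hg0 : (Int.gcd C N : ℤ) ≠ 0 := by
      intro h0
      have := (Int.gcd_eq_zero_iff.1 (by exact_mod_cast h0 : Int.gcd C N = 0)).2
      have : N = 0 := by exact_mod_cast this
      omega
    have hgl := Int.gcd_dvd_left C N
    have hgr : Int.gcd C N ∣ N := by exact_mod_cast Int.gcd_dvd_right C N
    have hbz := Int.gcd_eq_gcd_ab C N
    generalize Int.gcd C N = g0 at *
    obtain ⟨c', hc'⟩ := hgl
    obtain ⟨Q, hQ⟩ := hgr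
    have hQz : (N : ℤ) = g0 * Q := by exact_mod_cast hQ
    have hNz : (N : ℤ) = l * k := by exact_mod_cast hNl
    have hcQ : IsCoprime c' (Q : ℤ) := by
      refine ⟨Int.gcdA C N, Int.gcdB C N, ?_⟩
      apply mul_left_cancel₀ hg0
      generalize Int.gcdA C N = x at *
      generalize Int.gcdB C N = y at *
      linear_combination -hbz - x * hc' - y * hQz
    have hgQ : IsCoprime (g0 : ℤ) (Q : ℤ) := by
      rw [hQ] at hN
      exact Nat.isCoprime_iff_coprime.2 (Nat.coprime_of_squarefree_mul hN)
    have hcop2 : IsCoprime (Q : ℤ) ((g0 : ℤ) * c') := (IsCoprime.mul_left hgQ hcQ).symm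
    have hcop3 : IsCoprime D ((g0 : ℤ) * c') := by rw [← hc']; exact hcop.symm
    have hdne : d ≠ 0 := hd0
    have key : d * g0 * c' ^ 2 = - (D * c * Q) := by
      apply mul_left_cancel₀ hg0
      apply mul_left_cancel₀ hdne
      have e1 : (a * l) ^ 2 + b * c * N = 0 := by rw [hNz]; linear_combination (l : ℤ) * h
      rw [hC, hD, hc', hQz] at e1
      linear_combination e1
    have hDd : D ∣ d := by
      have h1 : D ∣ d * (g0 * c' ^ 2) := ⟨-(c * Q), by linear_combination key⟩
      refine IsCoprime.dvd_of_dvd_mul_right ?_ h1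
      have := IsCoprime.mul_right hcop3 hcop3.of_mul_right_right
      convert this using 1; ring
    obtain ⟨e, he⟩ := hDd
    have hDne : D ≠ 0 := by rintro rfl; exact hb (by simpa using hD)
    have key2 : e * (g0 * c' ^ 2) = - (c * Q) := by
      apply mul_left_cancel₀ hDne
      rw [he] at key
      linear_combination key
    have hQe : (Q : ℤ) ∣ e := by
      have h1 : (Q : ℤ) ∣ e * (g0 * c' ^ 2) := ⟨-c, by linear_combination key2⟩
      refine IsCoprime.dvd_of_dvd_mul_right ?_ h1
      have := IsCoprime.mul_right hcop2 hcop2.of_mul_right_right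
      convert this using 1; ring
    obtain ⟨m, hm⟩ := hQe
    have hQne : (Q : ℤ) ≠ 0 := by
      intro h0; rw [h0, mul_zero] at hQz
      have : N = 0 := by exact_mod_cast hQz
      omega
    refine ⟨Q, g0, c', D, m, hQ, IsCoprime.mul_left hcop2 hcop3, ?_, ?_, ?_, ?_⟩
    · rintro rfl
      apply hdne; rw [he, hm]; ring
    · apply mul_left_cancel₀ hl'
      have : (l : ℤ) * k = g0 * Q := by rw [← hNz, hQz]
      rw [he, hm, hc'] at hC
      linear_combination hC - m * c' * D * this
    · rw [hD, he, hm]; ring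
    · apply mul_left_cancel₀ hQne
      rw [hm] at key2
      linear_combination key2

lemma abs_det_le_Pfun (γ : M2) : |γ.det| ≤ Pfun γ := by
  rw [Matrix.det_fin_two, abs_le]; unfold Pfun
  generalize γ 0 0 = x
  generalize γ 0 1 = y
  generalize γ 1 0 = z
  generalize γ 1 1 = w
  constructor
  · linarith [sq_nonneg (x + w), sq_nonneg (y - z), add_sq x w, sub_sq y z]
  · linarith [sq_nonneg (x - w), sq_nonneg (y + z), sub_sq x w, add_sq y z]

lemma sq_add_sq_zero (x y : ℝ) (h : ¬ 0 < x ^ 2 + y ^ 2) : x = 0 ∧ y = 0 := by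
  constructor <;> nlinarith [sq_nonneg x, sq_nonneg y]

lemma moebius_im (s g : M2) (hs : s.det = 1) (hg : g.det = 1) :
    (moebius s (moebius g Complex.I)).im =
      ((s 1 0 * g 0 0 + s 1 1 * g 1 0) ^ 2 + (s 1 0 * g 0 1 + s 1 1 * g 1 1) ^ 2)⁻¹ := by
  rw [Matrix.det_fin_two] at hs hg
  have hden : ((g 1 0 : ℂ) * Complex.I + (g 1 1 : ℂ)) ≠ 0 := by
    intro h0
    have h1 := congrArg Complex.re h0
    have h2 := congrArg Complex.im h0
    simp at h1 h2
    rw [h1, h2] at hg; simp at hg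
  have e : moebius s (moebius g Complex.I) =
      (((s 0 0 * g 0 0 + s 0 1 * g 1 0 : ℝ) : ℂ) * Complex.I + ((s 0 0 * g 0 1 + s 0 1 * g 1 1 : ℝ) : ℂ))
      / (((s 1 0 * g 0 0 + s 1 1 * g 1 0 : ℝ) : ℂ) * Complex.I
        + ((s 1 0 * g 0 1 + s 1 1 * g 1 1 : ℝ) : ℂ)) := by
    unfold moebius
    rw [← mul_div_mul_right _ _ hden]
    congr 1
    · rw [add_mul, mul_assoc, div_mul_cancel₀ _ hden]; push_cast; ring
    · rw [add_mul, mul_assoc, div_mul_cancel₀ _ hden]; push_cast; ring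
  have hdet : (s 0 0 * g 0 0 + s 0 1 * g 1 0) * (s 1 0 * g 0 1 + s 1 1 * g 1 1)
     - (s 0 0 * g 0 1 + s 0 1 * g 1 1) * (s 1 0 * g 0 0 + s 1 1 * g 1 0) = 1 := by
    linear_combination hs * (g 0 0 * g 1 1 - g 0 1 * g 1 0) + hg
  rw [e]
  generalize s 0 0 * g 0 0 + s 0 1 * g 1 0 = A at *
  generalize s 1 0 * g 0 1 + s 1 1 * g 1 1 = D at *
  generalize s 0 0 * g 0 1 + s 0 1 * g 1 1 = B at *
  generalize s 1 0 * g 0 0 + s 1 1 * g 1 0 = C at *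
  rw [Complex.div_im]
  have hn : Complex.normSq ((C : ℂ) * Complex.I + (D : ℂ)) = C ^ 2 + D ^ 2 := by
    simp [Complex.normSq_apply]; ring
  rw [hn]
  simp
  rw [← sub_div, hdet, one_div]

/-- Lower bound on the first successive minimum of R(ℓ;g)⁰ with respect to Ψ(δ,1):
    every nonzero trace-zero γ ∈ R(ℓ;g) lying in Ψ(δ,L) forces
    L ≥ c·min{ℓ^{−1/2}, ℓ^{−1}H(g)^{−1}δ^{−1/2}}. -/
theorem stmt4 : ∃ c : ℝ, 0 < c ∧
    ∀ (N ℓ : ℕ) (g : M2) (δ L : ℝ), Squarefree N → 0 < N → 0 < ℓ → ℓ ∣ N →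
    g.det = 1 → 0 < δ → δ ≤ 1 → 0 < L →
    ∀ γ : M2, γ ∈ Rconj N ℓ g → γ.trace = 0 → γ ∈ PsiSet δ L → γ ≠ 0 →
    L ≥ c * min (Real.sqrt ℓ)⁻¹ ((ℓ : ℝ)⁻¹ * (Hgt N g)⁻¹ * (Real.sqrt δ)⁻¹) := by
  refine ⟨1 / 2, by norm_num, ?_⟩
  intro N l g δ L hN hNp hl hlN hg hδ hδ1 hL γ hγ htr hPsi hne
  obtain ⟨k, hk⟩ := hlN
  have hlR : (0 : ℝ) < l := by exact_mod_cast hl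
  have hNR : (N : ℝ) = l * k := by exact_mod_cast hk
  have hinv : g⁻¹ = !![g 1 1, -g 0 1; -g 1 0, g 0 0] := by
    rw [Matrix.inv_def, hg, Matrix.adjugate_fin_two]; simp
  have hu : IsUnit g.det := by rw [hg]; exact isUnit_one
  obtain ⟨M, hM⟩ : ∃ M, M = g * γ * g⁻¹ := ⟨_, rfl⟩
  have hγM : γ = g⁻¹ * M * g := by
    rw [hM]
    simp only [Matrix.mul_assoc]
    rw [Matrix.nonsing_inv_mul _ hu, Matrix.mul_one, ← Matrix.mul_assoc,
      Matrix.nonsing_inv_mul _ hu, Matrix.one_mul]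
  have hMtr : M.trace = 0 := by
    rw [hM, Matrix.trace_mul_comm, ← Matrix.mul_assoc, Matrix.nonsing_inv_mul _ hu,
      Matrix.one_mul, htr]
  have hMdet : M.det = γ.det := by
    rw [hM, Matrix.det_mul, Matrix.det_mul, mul_right_comm, ← Matrix.det_mul,
      Matrix.mul_nonsing_inv _ hu, Matrix.det_one, one_mul]
  have hMl : M ∈ Rlat N l := by rw [hM]; exact hγ
  obtain ⟨⟨a, ha⟩, ⟨b, hb⟩, ⟨c, hc⟩, -⟩ := hMl
  have hd : M 1 1 = -(a : ℝ) := by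
    rw [Matrix.trace_fin_two] at hMtr; linarith
  have hc' : M 1 0 = (c : ℝ) * k := by rw [hc, hNR]; field_simp
  have hMd : γ.det = -(((a ^ 2 * l + b * c * k : ℤ) : ℝ) / l) := by
    rw [← hMdet, Matrix.det_fin_two, ha, hb, hc', hd]
    push_cast; field_simp; ring
  obtain ⟨hP1, hP2⟩ := hPsi
  by_cases h0 : a ^ 2 * (l : ℤ) + b * c * k = 0
  · have hnz : ¬ (a = 0 ∧ b = 0 ∧ c = 0) := by
      rintro ⟨rfl, rfl, rfl⟩
      apply hne
      have : M = 0 := by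
        ext i j; fin_cases i <;> fin_cases j <;> simp [ha, hb, hc, hd]
      rw [hγM, this]; simp
    obtain ⟨Q, g0, x, D, m, hNQ, hcop, hm, ea, eb, ec⟩ :=
      int_param N l k hN hNp hl hk a b c h0 hnz
    have hQ : 0 < Q := Nat.pos_of_ne_zero (by rintro rfl; simp at hNQ; omega)
    have hQR : (0 : ℝ) < Q := by exact_mod_cast hQ
    have hNQR : (N : ℝ) = g0 * Q := by exact_mod_cast hNQ
    obtain ⟨p, q, hpq⟩ := hcop
    have hpqR : (p : ℝ) * (Q * D) + q * (g0 * x) = 1 := by exact_mod_cast hpq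
    have hsq : Real.sqrt Q ^ 2 = Q := Real.sq_sqrt hQR.le
    have hs0 : 0 < Real.sqrt Q := Real.sqrt_pos.2 hQR
    obtain ⟨σ, hσ⟩ : ∃ σ : M2, σ = (Real.sqrt Q)⁻¹ •
      !![(Q : ℝ) * p, ((-q : ℤ) : ℝ); (N : ℝ) * x, (Q : ℝ) * D] := ⟨_, rfl⟩
    have hσdet : σ.det = 1 := by
      rw [hσ, Matrix.det_smul, Matrix.det_fin_two]
      simp only [Fintype.card_fin, inv_pow, hsq]
      simp [hNQR]
      field_simp
      linear_combination hpqR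
    have hσA : σ ∈ AtkinLehner N :=
      ⟨hσdet, Q, p, -q, x, D, hQ, ⟨g0, by rw [hNQ, mul_comm]⟩, hσ⟩
    have him := moebius_im σ g hσdet hg
    have hu10 : σ 1 0 = (Real.sqrt Q)⁻¹ * (N * x) := by simp [hσ]
    have hu11 : σ 1 1 = (Real.sqrt Q)⁻¹ * (Q * D) := by simp [hσ]
    have haR : (a : ℝ) = m * k * x * D := by exact_mod_cast ea
    have hbR : (b : ℝ) = m * Q * D ^ 2 := by exact_mod_cast eb
    have hcR : (c : ℝ) = -(m * g0 * x ^ 2) := by exact_mod_cast ec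
    have hsi : (Real.sqrt Q)⁻¹ ^ 2 = (Q : ℝ)⁻¹ := by rw [inv_pow, hsq]
    have m00 : M 0 0 = m / l * (σ 1 0 * σ 1 1) := by
      have : σ 1 0 * σ 1 1 = l * k * x * D := by
        rw [hu10, hu11]
        calc _ = (Real.sqrt Q)⁻¹ ^ 2 * (N * x * Q * D) := by ring
          _ = _ := by rw [hsi, hNR]; field_simp
      rw [this, ha, haR]; field_simp
    have m01 : M 0 1 = m / l * (σ 1 1) ^ 2 := by
      rw [hu11, mul_pow, hsi, hb, hbR]; field_simp
    have m10 : M 1 0 = - (m / l * (σ 1 0) ^ 2) := by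
      rw [hu10, mul_pow, hsi, hc, hcR, hNQR]; field_simp
    have m11 : M 1 1 = - (m / l * (σ 1 0 * σ 1 1)) := by rw [hd, ← ha, m00]
    have hPf : Pfun γ = (m / l) ^ 2 / 2 * ((σ 1 0 * g 0 0 + σ 1 1 * g 1 0) ^ 2
        + (σ 1 0 * g 0 1 + σ 1 1 * g 1 1) ^ 2) ^ 2 := by
      rw [hγM, hinv]
      unfold Pfun
      simp only [Matrix.mul_apply, Fin.sum_univ_two, m00, m01, m10, m11]
      simp
      ring
    have hγd : γ.det = 0 := by rw [hMd, h0]; simp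
    have hpos : 0 < (σ 1 0 * g 0 0 + σ 1 1 * g 1 0) ^ 2
        + (σ 1 0 * g 0 1 + σ 1 1 * g 1 1) ^ 2 := by
      by_contra hcon
      obtain ⟨e1, e2⟩ := sq_add_sq_zero _ _ hcon
      rw [Matrix.det_fin_two] at hσdet hg
      have e3 : σ 1 0 = 0 := by linear_combination g 1 1 * e1 - g 1 0 * e2 - σ 1 0 * hg
      have e4 : σ 1 1 = 0 := by linear_combination g 0 0 * e2 - g 0 1 * e1 - σ 1 1 * hg
      rw [e3, e4] at hσdet; simp at hσdet
    generalize (σ 1 0 * g 0 0 + σ 1 1 * g 1 0) ^ 2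
        + (σ 1 0 * g 0 1 + σ 1 1 * g 1 1) ^ 2 = S at *
    refine le_trans (mul_le_mul_of_nonneg_left (min_le_right _ _) (by norm_num)) ?_
    by_cases hbdd : BddAbove ((fun σ => (moebius σ (moebius g Complex.I)).im) '' AtkinLehner N)
    · have hH : S⁻¹ ≤ Hgt N g := by
        rw [← him]; exact le_csSup hbdd ⟨σ, hσA, rfl⟩
      have hHp : 0 < Hgt N g := lt_of_lt_of_le (inv_pos.2 hpos) hH
      have hHi : (Hgt N g)⁻¹ ≤ S := inv_le_of_inv_le₀ hpos hH
      have hm1 : (1 : ℝ) ≤ (m : ℝ) ^ 2 := by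
        have : 1 ≤ m ^ 2 := by have := sq_pos_of_ne_zero hm; omega
        exact_mod_cast this
      have hsd : 0 < Real.sqrt δ := Real.sqrt_pos.2 hδ
      have hsd2 : Real.sqrt δ ^ 2 = δ := Real.sq_sqrt hδ.le
      have hmain : (l : ℝ)⁻¹ * (Hgt N g)⁻¹ ≤ 2 * Real.sqrt δ * L := by
        refine le_trans (mul_le_mul_of_nonneg_left hHi (by positivity)) ?_
        have h4 : ((l : ℝ)⁻¹ * S) ^ 2 ≤ (2 * Real.sqrt δ * L) ^ 2 := by
          have h5 : ((l : ℝ)⁻¹ * S) ^ 2 ≤ (m : ℝ) ^ 2 * ((l : ℝ)⁻¹ * S) ^ 2 :=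
            le_mul_of_one_le_left (sq_nonneg _) hm1
          have h6 : (m : ℝ) ^ 2 * ((l : ℝ)⁻¹ * S) ^ 2 = 2 * Pfun γ := by rw [hPf]; ring
          have h7 : (2 * Real.sqrt δ * L) ^ 2 = 4 * δ * L ^ 2 := by
            rw [mul_pow, mul_pow, hsd2]; ring
          rw [hγd] at hP2
          rw [h7]; linarith
        exact (sq_le_sq₀ (by positivity) (by positivity)).1 h4
      calc 1 / 2 * ((l : ℝ)⁻¹ * (Hgt N g)⁻¹ * (Real.sqrt δ)⁻¹)
          ≤ 1 / 2 * ((2 * Real.sqrt δ * L) * (Real.sqrt δ)⁻¹) := by gcongr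
        _ = L := by field_simp
    · have : Hgt N g = 0 := Real.sSup_of_not_bddAbove hbdd
      rw [this]; simp; exact hL.le
  · have habs : (1 : ℝ) ≤ |((a ^ 2 * l + b * c * k : ℤ) : ℝ)| := by
      exact_mod_cast Int.one_le_abs h0
    have hdl : (l : ℝ)⁻¹ ≤ |γ.det| := by
      rw [hMd, abs_neg, abs_div, abs_of_pos hlR, ← one_div]
      gcongr
    have hPd : |γ.det| ≤ Pfun γ := by
      exact abs_det_le_Pfun γ
    have h1 : (Real.sqrt l)⁻¹ ≤ L := by
      rw [← Real.sqrt_inv]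
      exact Real.sqrt_le_iff.2 ⟨hL.le, by linarith⟩
    have h2 : 0 ≤ (Real.sqrt l)⁻¹ := by positivity
    have h3 := min_le_left (Real.sqrt l)⁻¹ ((l : ℝ)⁻¹ * (Hgt N g)⁻¹ * (Real.sqrt δ)⁻¹)
    linarith
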